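/- Suppose E[S] = 1 and that for some integer n' ≥ 1 and fixed constants C_1, C_2 > 0, r_1 > s_1 > 1, and r_2 > 2: (i) for all t ≥ 1, E[|∑_{i=1}^{n'} N_i(t) − n' t|^{r_1}] ≤ C_1 n'^{r_1/2} t^{s_1}; and (ii) for all t ∈ [0,1], E[|∑_{i=1}^{n'} N_i(t) − n' t|^{r_2}] ≤ C_2 max(n' t, (n' t)^{r_2/2}). Then for all ν > 0 and all λ ≥ 8, P(sup_{t ≥ 0}(n' t − ∑_{i=1}^{n'} N_i(t) − ν t) ≥ λ) ≤ (100(r_1+r_2)^3 / ((s_1−1)(r_1−s_1)(r_2−2)))^{r_1+r_2+2} · (C_1 n'^{r_1/2} ν^{−s_1} λ^{−(r_1−s_1)} + C_2 n'^{r_2/2} (λν)^{−r_2/2}). -/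

import Mathlib

open MeasureTheory ProbabilityTheory
open scoped NNReal ENNReal

/-- The number of renewals in `[0, t]` of a renewal process whose successive renewal
intervals are `ξ 0, ξ 1, ξ 2, ...`. -/
noncomputable def renewalCount (ξ : ℕ → ℝ) (t : ℝ) : ℕ :=
  sSup {n : ℕ | ∑ i ∈ Finset.range n, ξ i ≤ t}

lemma ren_tail_meas (F : Measure ℝ) : Measurable (fun z => F (Set.Ioi z)) :=
  Antitone.measurable (fun _ _ h => measure_mono (Set.Ioi_subset_Ioi h))

lemma ren_cdf_meas (F : Measure ℝ) : Measurable (fun z => F (Set.Iic z)) :=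
  Monotone.measurable (fun _ _ h => measure_mono (Set.Iic_subset_Iic.2 h))

/-- Lebesgue measure on the positive half-line. -/
noncomputable def renL : Measure ℝ := volume.restrict (Set.Ioi (0:ℝ))

instance : SFinite renL := by unfold renL; infer_instance

/-- Equilibrium distribution of `F`. -/
noncomputable def renG (F : Measure ℝ) : Measure ℝ := renL.withDensity (fun z => F (Set.Ioi z))

lemma lintegral_renG (F : Measure ℝ) (f : ℝ → ℝ≥0∞) (hf : Measurable f) :
    ∫⁻ z, f z ∂(renG F) = ∫⁻ z in Set.Ioi 0, F (Set.Ioi z) * f z := by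
  unfold renG
  rw [lintegral_withDensity_eq_lintegral_mul _ (ren_tail_meas F) hf]
  rfl

lemma lintegral_renL (f : ℝ → ℝ≥0∞) :
    ∫⁻ z, f z ∂renL = ∫⁻ z in Set.Ioi 0, f z := rfl

lemma renL_eq (F : Measure ℝ) [IsProbabilityMeasure F] (hF : F (Set.Iio 0) = 0) :
    renL = renG F + renL ∗ F := by
  refine Measure.ext_of_lintegral _ fun f hf => ?_
  rw [lintegral_add_measure, lintegral_renG F f hf, Measure.lintegral_conv hf]
  have h1 : ∫⁻ x, ∫⁻ y, f (x + y) ∂F ∂renL = ∫⁻ u in Set.Ioi 0, F (Set.Iic u) * f u := by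
    rw [lintegral_lintegral_swap (by fun_prop)]
    have h2 : ∀ y, ∫⁻ x, f (x + y) ∂renL = ∫⁻ u, (Set.Ici y).indicator f u := by
      intro y
      rw [lintegral_renL, restrict_Ioi_eq_restrict_Ici, ← lintegral_indicator measurableSet_Ici]
      rw [← lintegral_add_right_eq_self ((Set.Ici y).indicator f) y]
      refine lintegral_congr fun x => ?_
      simp [Set.indicator]
    simp_rw [h2]
    rw [lintegral_lintegral_swap]
    · rw [← lintegral_indicator measurableSet_Ioi]
      have h3 : ∀ᵐ y ∂(volume : Measure ℝ), y ≠ 0 := by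
        rw [ae_iff]; simp
      refine lintegral_congr_ae ?_
      filter_upwards [h3] with u hu
      have h4 : ∀ y, (Set.Ici y).indicator f u = (Set.Iic u).indicator (fun _ => f u) y := by
        intro y; simp [Set.indicator]
      simp_rw [h4]
      rw [lintegral_indicator_const measurableSet_Iic]
      by_cases hu0 : 0 < u
      · rw [Set.indicator_of_mem (by simpa using hu0), mul_comm]
      · rw [Set.indicator_of_notMem (by simpa using hu0)]
        have : F (Set.Iic u) = 0 := measure_mono_null (fun x hx => by
          simp only [Set.mem_Iic, Set.mem_Iio] at *
          exact lt_of_le_of_lt hx (lt_of_le_of_ne (not_lt.1 hu0) hu)) hF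
        simp [this]
    · refine Measurable.aemeasurable ?_
      have : (Function.uncurry fun (y u : ℝ) => (Set.Ici y).indicator f u)
          = {p : ℝ × ℝ | p.1 ≤ p.2}.indicator (fun p => f p.2) := by
        ext p; simp [Set.indicator, Function.uncurry]
      rw [this]
      exact (hf.comp measurable_snd).indicator (measurableSet_le measurable_fst measurable_snd)
  have hm : Measurable fun z => F (Set.Ioi z) * f z := (ren_tail_meas F).mul hf
  rw [h1, lintegral_renL, ← lintegral_add_left hm]
  refine lintegral_congr fun u => ?_
  rw [← add_mul, add_comm, ← measure_union (by
    rw [Set.disjoint_left]; intro x hx hx'; simp at *; linarith) measurableSet_Ioi,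
    Set.Iic_union_Ioi, measure_univ, one_mul]

lemma ren_resid (F : Measure ℝ) [IsProbabilityMeasure F] (s : ℝ) (hs : 0 ≤ s)
    (k : ℝ → ℝ≥0∞) (hk : Measurable k) (hk0 : ∀ x ≤ 0, k x = 0) :
    ∫⁻ z, k (z - s) ∂(renG F) + ∫⁻ u in Set.Ioc 0 s, ∫⁻ v, k (u + v - s) ∂F
      = ∫⁻ z, k z ∂(renG F) := by
  have hA : ∫⁻ z, k (z - s) ∂(renG F) = ∫⁻ y in Set.Ioi 0, F (Set.Ioi (y + s)) * k y := by
    rw [lintegral_renG F _ (by fun_prop), ← lintegral_indicator measurableSet_Ioi,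
      ← lintegral_indicator measurableSet_Ioi, ← lintegral_add_right_eq_self _ s]
    refine lintegral_congr fun y => ?_
    simp only [Set.indicator, Set.mem_Ioi, add_sub_cancel_right]
    by_cases hy : 0 < y
    · rw [if_pos hy, if_pos (by linarith)]
    · rw [if_neg hy, hk0 y (not_lt.1 hy)]; simp
  have hB : ∫⁻ u in Set.Ioc 0 s, ∫⁻ v, k (u + v - s) ∂F
      = ∫⁻ y in Set.Ioi 0, F (Set.Ioc y (y + s)) * k y := by
    rw [Measure.restrict_congr_set (Ico_ae_eq_Ioc (μ := (volume : Measure ℝ)) (a := (0:ℝ)) (b := s)).symm]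
    rw [lintegral_lintegral_swap (by fun_prop)]
    have h2 : ∀ v, ∫⁻ u in Set.Ico 0 s, k (u + v - s)
        = ∫⁻ y, (Set.Ico (v - s) v).indicator k y := by
      intro v
      rw [← lintegral_indicator measurableSet_Ico]
      rw [← lintegral_add_right_eq_self ((Set.Ico (v - s) v).indicator k) (v - s)]
      refine lintegral_congr fun x => ?_
      simp only [Set.indicator, Set.mem_Ico]
      have e : x + (v - s) = x + v - s := by ring
      rw [e]
      congr 1
      apply propext
      constructor <;> rintro ⟨a, b⟩ <;> constructor <;> linarith
    simp_rw [h2]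
    rw [lintegral_lintegral_swap]
    · rw [← lintegral_indicator measurableSet_Ioi]
      refine lintegral_congr fun y => ?_
      have h4 : ∀ v, (Set.Ico (v - s) v).indicator k y
          = (Set.Ioc y (y + s)).indicator (fun _ => k y) v := by
        intro v
        simp only [Set.indicator, Set.mem_Ico, Set.mem_Ioc]
        congr 1
        apply propext
        constructor <;> rintro ⟨a, b⟩ <;> constructor <;> linarith
      simp_rw [h4]
      rw [lintegral_indicator_const measurableSet_Ioc]
      by_cases hy : 0 < y
      · rw [Set.indicator_of_mem (by simpa using hy), mul_comm]
      · rw [Set.indicator_of_notMem (by simpa using hy), hk0 y (not_lt.1 hy)]; simp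
    · refine Measurable.aemeasurable ?_
      have : (Function.uncurry fun (v y : ℝ) => (Set.Ico (v - s) v).indicator k y)
          = {p : ℝ × ℝ | p.1 - s ≤ p.2 ∧ p.2 < p.1}.indicator (fun p => k p.2) := by
        ext p; simp [Set.indicator, Function.uncurry]
      rw [this]
      have hset : MeasurableSet ({p : ℝ × ℝ | p.1 - s ≤ p.2} ∩ {p : ℝ × ℝ | p.2 < p.1}) :=
        (measurableSet_le (by fun_prop) (by fun_prop)).inter
          (measurableSet_lt (by fun_prop) (by fun_prop))
      exact (hk.comp measurable_snd).indicator hset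
  have hm : Measurable fun y => F (Set.Ioi (y + s)) * k y :=
    ((ren_tail_meas F).comp (measurable_id.add_const s)).mul hk
  rw [hA, hB, lintegral_renG F k hk, ← lintegral_add_left hm]
  refine lintegral_congr fun y => ?_
  rw [← add_mul, add_comm, ← measure_union (by
    rw [Set.disjoint_left]; intro x hx hx'; simp at *; linarith) measurableSet_Ioi,
    Set.Ioc_union_Ioi_eq_Ioi (by linarith)]

/-- iterated convolution. -/
noncomputable def renLk (F : Measure ℝ) : ℕ → Measure ℝ
  | 0 => renL
  | k + 1 => renLk F k ∗ F

lemma renLk_sfinite (F : Measure ℝ) [IsProbabilityMeasure F] (k : ℕ) : SFinite (renLk F k) := by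
  induction k with
  | zero => exact (inferInstance : SFinite renL)
  | succ k ih => unfold renLk; infer_instance

lemma renLk_exp (F : Measure ℝ) [IsProbabilityMeasure F] (k : ℕ) :
    ∫⁻ u, ENNReal.ofReal (Real.exp (-u)) ∂(renLk F k)
      = (∫⁻ u, ENNReal.ofReal (Real.exp (-u)) ∂F) ^ k := by
  induction k with
  | zero =>
    simp only [renLk, pow_zero]
    rw [lintegral_renL, ← ofReal_integral_eq_lintegral_ofReal]
    · rw [integral_exp_neg_Ioi_zero]; simp
    · exact (exp_neg_integrableOn_Ioi 0 one_pos).congr_fun (fun x _ => by simp) measurableSet_Ioi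
    · exact Filter.Eventually.of_forall fun x => (Real.exp_pos _).le
  | succ k ih =>
    have := renLk_sfinite F k
    rw [renLk, Measure.lintegral_conv (by fun_prop), pow_succ, ← ih,
      ← lintegral_mul_const _ (by fun_prop)]
    refine lintegral_congr fun x => ?_
    rw [← lintegral_const_mul _ (by fun_prop)]
    refine lintegral_congr fun y => ?_
    rw [← ENNReal.ofReal_mul (Real.exp_pos _).le, ← Real.exp_add]
    congr 2; ring

lemma ren_phi_lt (F : Measure ℝ) [IsProbabilityMeasure F] (hF : F (Set.Iio 0) = 0)
    (hF' : F (Set.Ioi 0) ≠ 0) : ∫⁻ u, ENNReal.ofReal (Real.exp (-u)) ∂F < 1 := by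
  have h1 : ∀ᵐ u ∂F, 0 ≤ u := by
    rw [ae_iff]; simpa [Set.Iio] using hF
  have hle : (fun u => ENNReal.ofReal (Real.exp (-u))) ≤ᵐ[F] fun _ => 1 := by
    filter_upwards [h1] with u hu
    rw [← ENNReal.ofReal_one]
    exact ENNReal.ofReal_le_ofReal (by simpa using hu)
  have := lintegral_strict_mono_of_ae_le_of_ae_lt_on (μ := F)
    (f := fun u => ENNReal.ofReal (Real.exp (-u))) (g := fun _ => 1) (by fun_prop)
    (by
      have := lintegral_mono_ae hle
      simp only [lintegral_one, measure_univ] at this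
      exact (lt_of_le_of_lt this ENNReal.one_lt_top).ne) hle hF' (by
      refine Filter.Eventually.of_forall fun u hu => ?_
      rw [← ENNReal.ofReal_one]
      exact (ENNReal.ofReal_lt_ofReal_iff one_pos).2 (by simpa using hu))
  simpa using this

lemma ren_sum (F : Measure ℝ) [IsProbabilityMeasure F] (hF : F (Set.Iio 0) = 0)
    (hF' : F (Set.Ioi 0) ≠ 0) (V : ℕ → Measure ℝ) [∀ k, IsProbabilityMeasure (V k)]
    (hV0 : V 0 = renG F) (hV : ∀ k, V (k+1) = V k ∗ F)
    (g : ℝ → ℝ≥0∞) (c : ℝ≥0∞) (hc : c ≠ ∞)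
    (hgc : ∀ u, g u ≤ c * ENNReal.ofReal (Real.exp (-u))) :
    ∑' k, ∫⁻ u, g u ∂(V k) = ∫⁻ u, g u ∂renL := by
  have hstep : ∀ k, renLk F k = V k + renLk F (k+1) := by
    intro k
    induction k with
    | zero => rw [hV0]; exact renL_eq F hF
    | succ k ih =>
      have := renLk_sfinite F (k+1)
      have := renLk_sfinite F k
      conv_lhs => rw [renLk, ih]
      rw [Measure.add_conv, hV]
      rfl
  have hb : ∀ k, ∫⁻ u, g u ∂(renLk F k) ≤ c * (∫⁻ u, ENNReal.ofReal (Real.exp (-u)) ∂F) ^ k := by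
    intro k
    rw [← renLk_exp, ← lintegral_const_mul _ (by fun_prop)]
    exact lintegral_mono hgc
  have hpart : ∀ k, ∫⁻ u, g u ∂renL
      = ∑ i ∈ Finset.range k, ∫⁻ u, g u ∂(V i) + ∫⁻ u, g u ∂(renLk F k) := by
    intro k
    induction k with
    | zero => simp [renLk]
    | succ k ih =>
      rw [ih, Finset.sum_range_succ, hstep k, lintegral_add_measure, add_assoc]
  have hlim : Filter.Tendsto (fun k => ∫⁻ u, g u ∂(renLk F k)) Filter.atTop (nhds 0) := by
    refine tendsto_of_tendsto_of_tendsto_of_le_of_le tendsto_const_nhds ?_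
      (fun _ => zero_le) hb
    have := ENNReal.Tendsto.const_mul (a := c)
      (ENNReal.tendsto_pow_atTop_nhds_zero_of_lt_one (ren_phi_lt F hF hF')) (Or.inr hc)
    simpa using this
  have h1 := ENNReal.tendsto_nat_tsum (fun i => ∫⁻ u, g u ∂(V i))
  have h2 := h1.add hlim
  simp_rw [← hpart] at h2
  have := tendsto_nhds_unique tendsto_const_nhds h2
  rw [this, add_zero]

lemma ren_count_mono_set {x : ℕ → ℝ} (hx : ∀ j, 0 ≤ x j) {m n : ℕ} (h : m ≤ n) :
    ∑ i ∈ Finset.range m, x i ≤ ∑ i ∈ Finset.range n, x i :=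
  Finset.sum_le_sum_of_subset_of_nonneg (Finset.range_mono h) (fun i _ _ => hx i)

lemma ren_count_iff {x : ℕ → ℝ} (hx : ∀ j, 0 ≤ x j) {t : ℝ} (ht : 0 ≤ t)
    (hb : BddAbove {n : ℕ | ∑ i ∈ Finset.range n, x i ≤ t}) (m : ℕ) :
    m ≤ renewalCount x t ↔ ∑ i ∈ Finset.range m, x i ≤ t := by
  constructor
  · intro h
    have hmem : sSup {n : ℕ | ∑ i ∈ Finset.range n, x i ≤ t}
        ∈ {n : ℕ | ∑ i ∈ Finset.range n, x i ≤ t} :=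
      Nat.sSup_mem ⟨0, by simpa using ht⟩ hb
    exact (ren_count_mono_set hx h).trans hmem
  · intro h
    exact le_csSup hb h

lemma ren_incr_iff {x : ℕ → ℝ} (hx : ∀ j, 0 ≤ x j) {s t : ℝ} (hs : 0 ≤ s) (ht : 0 ≤ t)
    (hb : ∀ t, BddAbove {n : ℕ | ∑ i ∈ Finset.range n, x i ≤ t}) (p : ℕ) :
    p + 1 ≤ renewalCount x (s + t) - renewalCount x s ↔
      ∃ k, ∑ i ∈ Finset.range k, x i ≤ s ∧ s < ∑ i ∈ Finset.range (k+1), x i ∧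
        ∑ i ∈ Finset.range (k + 1 + p), x i ≤ s + t := by
  constructor
  · intro h
    refine ⟨renewalCount x s, (ren_count_iff hx hs (hb s) _).1 le_rfl, ?_, ?_⟩
    · by_contra hcon
      have := (ren_count_iff hx hs (hb s) _).2 (not_lt.1 hcon)
      omega
    · exact (ren_count_iff hx (add_nonneg hs ht) (hb _) _).1 (by omega)
  · rintro ⟨k, h1, h2, h3⟩
    have a1 := (ren_count_iff hx hs (hb s) _).2 h1
    have a2 : ¬ (k + 1 ≤ renewalCount x s) := fun hcon =>
      absurd ((ren_count_iff hx hs (hb s) _).1 hcon) (not_le.2 h2)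
    have a3 := (ren_count_iff hx (add_nonneg hs ht) (hb _) _).2 h3
    omega

lemma ren_count_meas (t : ℝ) : Measurable (fun x : ℕ → ℝ => renewalCount x t) := by
  have hZ : ∀ n, MeasurableSet {x : ℕ → ℝ | ∑ i ∈ Finset.range n, x i ≤ t} := fun n =>
    measurableSet_le (by fun_prop) (by fun_prop)
  refine measurable_of_Ici fun m => ?_
  rcases Nat.eq_zero_or_pos m with rfl | hm
  · simp
  have : (fun x : ℕ → ℝ => renewalCount x t) ⁻¹' Set.Ici m
      = (⋃ b : ℕ, ⋂ n : ℕ, {x | b < n → ¬ (∑ i ∈ Finset.range n, x i ≤ t)}) ∩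
        (⋃ n : ℕ, {x | m ≤ n ∧ ∑ i ∈ Finset.range n, x i ≤ t}) := by
    ext x
    simp only [Set.mem_preimage, Set.mem_Ici, Set.mem_inter_iff, Set.mem_iUnion, Set.mem_iInter,
      Set.mem_ofPred_eq]
    constructor
    · intro h
      have hb : BddAbove {n : ℕ | ∑ i ∈ Finset.range n, x i ≤ t} := by
        by_contra hcon
        have : renewalCount x t = 0 := Nat.sSup_of_not_bddAbove hcon
        omega
      have hne : {n : ℕ | ∑ i ∈ Finset.range n, x i ≤ t}.Nonempty := by
        by_contra hcon
        rw [Set.not_nonempty_iff_eq_empty] at hcon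
        have : renewalCount x t = 0 := by simp [renewalCount, hcon]
        omega
      obtain ⟨b, hb'⟩ := id hb
      refine ⟨⟨b, fun n hn hcon => ?_⟩, _, h, Nat.sSup_mem hne hb⟩
      have := hb' hcon
      omega
    · rintro ⟨⟨b, hb⟩, n, hn, hn'⟩
      refine hn.trans (le_csSup ⟨b, fun j hj => ?_⟩ hn')
      by_contra hcon
      exact hb j (not_le.1 hcon) hj
  rw [this]
  refine (MeasurableSet.iUnion fun b => MeasurableSet.iInter fun n => ?_).inter
    (MeasurableSet.iUnion fun n => ?_)
  · exact (MeasurableSet.const _).imp (hZ n).compl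
  · exact (MeasurableSet.const _).inter (hZ n)

section single
variable {Ω : Type*} [MeasurableSpace Ω] {μ : Measure Ω} [IsProbabilityMeasure μ]

lemma ren_term (X Y W : Ω → ℝ) (hX : Measurable X) (hY : Measurable Y) (hW : Measurable W)
    (hXY : IndepFun X Y μ) (hXYW : IndepFun (fun ω => (X ω, Y ω)) W μ) (s t : ℝ)
    (H : Measure ℝ) (hH : μ.map W = H) :
    μ {ω | X ω ≤ s ∧ s < X ω + Y ω ∧ X ω + Y ω + W ω ≤ s + t}
      = ∫⁻ u, (Set.Iic s).indicator
          (fun u => ∫⁻ v, (Set.Ioi 0).indicator (fun y => H (Set.Iic (t - y))) (u + v - s)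
            ∂(μ.map Y)) u ∂(μ.map X) := by
  have h1 := hXY.map_prod_eq_prod_map_map hX.aemeasurable hY.aemeasurable
  have h2 := hXYW.map_prod_eq_prod_map_map (hX.prodMk hY).aemeasurable hW.aemeasurable
  have : IsProbabilityMeasure H := hH ▸ Measure.isProbabilityMeasure_map hW.aemeasurable
  have : IsProbabilityMeasure (μ.map X) := Measure.isProbabilityMeasure_map hX.aemeasurable
  have : IsProbabilityMeasure (μ.map Y) := Measure.isProbabilityMeasure_map hY.aemeasurable
  set B : Set ((ℝ × ℝ) × ℝ) := {p | p.1.1 ≤ s} ∩ ({p | s < p.1.1 + p.1.2} ∩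
    {p | p.1.1 + p.1.2 + p.2 ≤ s + t}) with hB
  have hBm : MeasurableSet B := (measurableSet_le (by fun_prop) (by fun_prop)).inter
    ((measurableSet_lt (by fun_prop) (by fun_prop)).inter
      (measurableSet_le (by fun_prop) (by fun_prop)))
  have e1 : μ {ω | X ω ≤ s ∧ s < X ω + Y ω ∧ X ω + Y ω + W ω ≤ s + t}
      = (μ.map (fun ω => ((X ω, Y ω), W ω))) B := by
    rw [Measure.map_apply ((hX.prodMk hY).prodMk hW) hBm]; rfl
  rw [e1, h2, h1, hH, Measure.prod_apply hBm, lintegral_prod _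
    (measurable_measure_prodMk_left hBm).aemeasurable]
  refine lintegral_congr fun u => ?_
  by_cases hu : u ≤ s
  · rw [Set.indicator_of_mem (by simpa using hu)]
    refine lintegral_congr fun v => ?_
    by_cases hv : s < u + v
    · rw [Set.indicator_of_mem (by simpa using hv)]
      congr 1
      ext w
      simp only [hB, Set.mem_preimage, Set.mem_inter_iff, Set.mem_ofPred_eq, Set.mem_Iic]
      constructor
      · rintro ⟨_, _, h⟩; linarith
      · intro h; exact ⟨hu, hv, by linarith⟩
    · rw [Set.indicator_of_notMem (by simpa using hv)]
      have : Prod.mk (u, v) ⁻¹' B = ∅ := by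
        ext w; simp [hB, hv]
      rw [this, measure_empty]
  · rw [Set.indicator_of_notMem (by simpa using hu)]
    have : ∀ v, Prod.mk (u, v) ⁻¹' B = ∅ := by
      intro v; ext w; simp [hB, hu]
    simp [this]

/-- law of a sum of `p` i.i.d. copies. -/
noncomputable def renH (F : Measure ℝ) : ℕ → Measure ℝ
  | 0 => Measure.dirac 0
  | k + 1 => renH F k ∗ F

lemma renH_law (F : Measure ℝ) (ξ : ℕ → Ω → ℝ) (hm : ∀ j, Measurable (ξ j))
    (hind : iIndepFun ξ μ) (hlaw : ∀ j, μ.map (ξ (j+1)) = F) (k p : ℕ) :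
    μ.map (fun ω => ∑ i ∈ Finset.Ico (k+1) (k+1+p), ξ i ω) = renH F p := by
  induction p with
  | zero => simp [renH]
  | succ p ih =>
    have hi : IndepFun (∑ i ∈ Finset.Ico (k+1) (k+1+p), ξ i) (ξ (k+1+p)) μ :=
      hind.indepFun_finsetSum_of_notMem hm (by simp)
    have := hi.map_add_eq_map_conv_map (by
      have : (∑ i ∈ Finset.Ico (k+1) (k+1+p), ξ i)
        = fun ω => ∑ i ∈ Finset.Ico (k+1) (k+1+p), ξ i ω := by ext; simp
      rw [this]; fun_prop) (hm _)
    have e1 : (∑ i ∈ Finset.Ico (k+1) (k+1+p), ξ i)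
        = fun ω => ∑ i ∈ Finset.Ico (k+1) (k+1+p), ξ i ω := by ext; simp
    have e2 : (∑ i ∈ Finset.Ico (k+1) (k+1+p), ξ i) + ξ (k+1+p)
        = fun ω => ∑ i ∈ Finset.Ico (k+1) (k+1+(p+1)), ξ i ω := by
      ext ω
      rw [← add_assoc, Finset.sum_Ico_succ_top (by omega)]; simp
    rw [e2, e1, ih, show k + 1 + p = (k + p) + 1 by ring, hlaw] at this
    rw [renH, ← this, show k + 1 + (p + 1) = k + p + 1 + 1 by ring]

lemma ren_V (F : Measure ℝ) (ξ : ℕ → Ω → ℝ) (hm : ∀ j, Measurable (ξ j))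
    (hind : iIndepFun ξ μ) (hlaw : ∀ j, μ.map (ξ (j+1)) = F) (k : ℕ) :
    μ.map (fun ω => ∑ i ∈ Finset.range (k+1+1), ξ i ω)
      = μ.map (fun ω => ∑ i ∈ Finset.range (k+1), ξ i ω) ∗ F := by
  have hi : IndepFun (∑ i ∈ Finset.range (k+1), ξ i) (ξ (k+1)) μ :=
    hind.indepFun_finsetSum_of_notMem hm (by simp)
  have e1 : (∑ i ∈ Finset.range (k+1), ξ i)
      = fun ω => ∑ i ∈ Finset.range (k+1), ξ i ω := by ext; simp
  have e2 : (∑ i ∈ Finset.range (k+1), ξ i) + ξ (k+1)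
      = fun ω => ∑ i ∈ Finset.range (k+1+1), ξ i ω := by
    ext ω
    rw [Finset.sum_range_succ _ (k+1)]; simp
  have := hi.map_add_eq_map_conv_map (by rw [e1]; fun_prop) (hm _)
  rwa [e2, e1, hlaw] at this

lemma ren_bdd (F : Measure ℝ) [IsProbabilityMeasure F] (hF : F (Set.Iio 0) = 0)
    (hF' : F (Set.Ioi 0) ≠ 0) (ξ : ℕ → Ω → ℝ) (hm : ∀ j, Measurable (ξ j))
    (hind : iIndepFun ξ μ) (hlaw : ∀ j, μ.map (ξ (j+1)) = F) (h0 : μ.map (ξ 0) = renG F) :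
    ∀ᵐ ω ∂μ, ∀ t : ℝ, BddAbove {n : ℕ | ∑ i ∈ Finset.range n, ξ i ω ≤ t} := by
  have hp : ∀ k, IsProbabilityMeasure (μ.map (fun ω => ∑ i ∈ Finset.range (k+1), ξ i ω)) :=
    fun k => Measure.isProbabilityMeasure_map (Measurable.aemeasurable (by fun_prop))
  have key : ∀ N : ℕ, ∀ᵐ ω ∂μ, ∀ᶠ k in Filter.atTop,
      ω ∉ {ω | ∑ i ∈ Finset.range (k+1), ξ i ω ≤ (N:ℝ)} := by
    intro N
    refine ae_eventually_notMem ?_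
    have := ren_sum F hF hF' (fun k => μ.map (fun ω => ∑ i ∈ Finset.range (k+1), ξ i ω))
      (by simpa using h0) (fun k => ren_V F ξ hm hind hlaw k)
      ((Set.Iic (N:ℝ)).indicator 1) (ENNReal.ofReal (Real.exp N)) ENNReal.ofReal_ne_top (by
        intro u
        by_cases hu : u ≤ N
        · rw [Set.indicator_of_mem (by simpa using hu), ← ENNReal.ofReal_mul (Real.exp_pos _).le,
            ← Real.exp_add, Pi.one_apply, ← ENNReal.ofReal_one]
          exact ENNReal.ofReal_le_ofReal (Real.one_le_exp (by linarith))
        · rw [Set.indicator_of_notMem (by simpa using hu)]; exact zero_le)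
    simp_rw [lintegral_indicator_one measurableSet_Iic] at this
    have e : ∀ k, μ {ω | ∑ i ∈ Finset.range (k+1), ξ i ω ≤ (N:ℝ)}
        = μ.map (fun ω => ∑ i ∈ Finset.range (k+1), ξ i ω) (Set.Iic (N:ℝ)) := by
      intro k
      rw [Measure.map_apply (by fun_prop) measurableSet_Iic]; rfl
    simp_rw [e]
    rw [this, renL, Measure.restrict_apply measurableSet_Iic, Set.Iic_inter_Ioi, Real.volume_Ioc]
    exact ENNReal.ofReal_ne_top
  filter_upwards [ae_all_iff.2 key] with ω hω t
  obtain ⟨N, hN⟩ := exists_nat_ge t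
  obtain ⟨K, hK⟩ := Filter.eventually_atTop.1 (hω N)
  refine ⟨K + 1, fun n hn => ?_⟩
  by_contra hcon
  obtain ⟨q, rfl⟩ : ∃ q, n = q + 1 := ⟨n - 1, by omega⟩
  exact hK q (by omega) (le_trans hn hN)

lemma ren_incr_law (F : Measure ℝ) [IsProbabilityMeasure F] (hF : F (Set.Iio 0) = 0)
    (hF' : F (Set.Ioi 0) ≠ 0) (ξ : ℕ → Ω → ℝ) (hm : ∀ j, Measurable (ξ j))
    (hnn : ∀ j, ∀ᵐ ω ∂μ, 0 ≤ ξ j ω)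
    (hind : iIndepFun ξ μ) (hlaw : ∀ j, μ.map (ξ (j+1)) = F) (h0 : μ.map (ξ 0) = renG F)
    (s t : ℝ) (hs : 0 ≤ s) (ht : 0 ≤ t) (p : ℕ) :
    μ {ω | p + 1 ≤ renewalCount (fun j => ξ j ω) (s + t) - renewalCount (fun j => ξ j ω) s}
      = ∫⁻ z, (Set.Ioi 0).indicator (fun y => renH F p (Set.Iic (t - y))) z ∂(renG F) := by
  have hp : ∀ k, IsProbabilityMeasure (μ.map (fun ω => ∑ i ∈ Finset.range (k+1), ξ i ω)) :=
    fun k => Measure.isProbabilityMeasure_map (Measurable.aemeasurable (by fun_prop))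
  have hHp : IsProbabilityMeasure (renH F p) := by
    rw [← renH_law F ξ hm hind hlaw 0 p]
    exact Measure.isProbabilityMeasure_map (Measurable.aemeasurable (by fun_prop))
  have hbdd := ren_bdd F hF hF' ξ hm hind hlaw h0
  set D : ℕ → Set Ω := fun k => {ω | ∑ i ∈ Finset.range k, ξ i ω ≤ s ∧
    s < ∑ i ∈ Finset.range k, ξ i ω + ξ k ω ∧
    ∑ i ∈ Finset.range k, ξ i ω + ξ k ω + ∑ i ∈ Finset.Ico (k+1) (k+1+p), ξ i ω ≤ s + t} with hD
  have hDm : ∀ k, MeasurableSet (D k) := fun k => by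
    have : MeasurableSet ({ω | ∑ i ∈ Finset.range k, ξ i ω ≤ s} ∩
      ({ω | s < ∑ i ∈ Finset.range k, ξ i ω + ξ k ω} ∩
      {ω | ∑ i ∈ Finset.range k, ξ i ω + ξ k ω
        + ∑ i ∈ Finset.Ico (k+1) (k+1+p), ξ i ω ≤ s + t})) :=
      (measurableSet_le (by fun_prop) (by fun_prop)).inter
      ((measurableSet_lt (by fun_prop) (by fun_prop)).inter
        (measurableSet_le (by fun_prop) (by fun_prop)))
    exact this
  have hae : {ω | p + 1 ≤ renewalCount (fun j => ξ j ω) (s + t)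
      - renewalCount (fun j => ξ j ω) s} =ᵐ[μ] ⋃ k, D k := by
    rw [Filter.eventuallyEq_set]
    filter_upwards [ae_all_iff.2 hnn, hbdd] with ω h1 h2
    rw [ren_incr_iff h1 hs ht h2, Set.mem_iUnion]
    refine exists_congr fun k => ?_
    rw [hD, Set.mem_ofPred_eq, ← Finset.sum_range_succ (fun i => ξ i ω),
      Finset.sum_range_add_sum_Ico (fun i => ξ i ω) (by omega)]
  rw [measure_congr hae, measure_iUnion₀ ?_ (fun k => (hDm k).nullMeasurableSet)]
  · set kf : ℝ → ℝ≥0∞ := (Set.Ioi 0).indicator (fun y => renH F p (Set.Iic (t - y))) with hkf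
    have hkm : Measurable kf :=
      ((ren_cdf_meas (renH F p)).comp (measurable_const.sub measurable_id)).indicator
        measurableSet_Ioi
    have hk0 : ∀ x ≤ 0, kf x = 0 := fun x hx => by
      rw [hkf, Set.indicator_of_notMem (by simpa using hx)]
    have hk1 : ∀ x, kf x ≤ 1 := fun x => by
      exact Set.indicator_le' (s := Set.Ioi 0) (g := fun _ => 1) (fun y _ => prob_le_one)
        (fun _ _ => zero_le) x
    have hterm : ∀ k, μ (D k) = ∫⁻ u, (Set.Iic s).indicator
        (fun u => ∫⁻ v, kf (u + v - s) ∂(μ.map (ξ k))) u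
          ∂(μ.map (fun ω => ∑ i ∈ Finset.range k, ξ i ω)) := by
      intro k
      refine ren_term (fun ω => ∑ i ∈ Finset.range k, ξ i ω) (ξ k)
        (fun ω => ∑ i ∈ Finset.Ico (k+1) (k+1+p), ξ i ω) (by fun_prop) (hm k) (by fun_prop)
        ?_ ?_ s t _ (renH_law F ξ hm hind hlaw k p)
      · have := hind.indepFun_finsetSum_of_notMem hm (s := Finset.range k) (i := k) (by simp)
        have e1 : (∑ i ∈ Finset.range k, ξ i)
          = fun ω => ∑ i ∈ Finset.range k, ξ i ω := by ext; simp
        rwa [e1] at this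
      · have := hind.indepFun_finset (Finset.range (k+1)) (Finset.Ico (k+1) (k+1+p)) (by
          rw [Finset.disjoint_left]; intro a ha ha'; simp at *; omega) hm
        have h3 := this.comp
          (φ := fun x : (Finset.range (k+1) → ℝ) =>
            (∑ i : Finset.range k, x ⟨i.1, by have := Finset.mem_range.1 i.2; exact Finset.mem_range.2 (by omega)⟩, x ⟨k, by simp⟩))
          (ψ := fun x : (Finset.Ico (k+1) (k+1+p) → ℝ) => ∑ i, x i) (by fun_prop) (by fun_prop)
        convert! h3 using 1
        · ext ω
          · simp only [Function.comp]
            rw [← Finset.sum_coe_sort]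
          · simp
        · ext ω
          simp only [Function.comp]
          rw [← Finset.sum_coe_sort]
    rw [tsum_eq_zero_add' ENNReal.summable]
    rw [← ren_resid F s hs kf hkm hk0]
    congr 1
    · rw [hterm, h0]
      simp only [Finset.range_zero, Finset.sum_empty, Measure.map_const, measure_univ, one_smul]
      rw [lintegral_dirac, Set.indicator_of_mem (by simpa using hs)]
      simp
    · simp_rw [hterm, hlaw]
      rw [ren_sum F hF hF' (fun k => μ.map (fun ω => ∑ i ∈ Finset.range (k+1), ξ i ω))
        (by simpa using h0) (fun k => ren_V F ξ hm hind hlaw k) _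
        (ENNReal.ofReal (Real.exp s)) ENNReal.ofReal_ne_top]
      · rw [lintegral_indicator measurableSet_Iic, renL,
          Measure.restrict_restrict measurableSet_Iic, Set.Iic_inter_Ioi]
      · intro u
        by_cases hu : u ≤ s
        · rw [Set.indicator_of_mem (by simpa using hu), ← ENNReal.ofReal_mul (Real.exp_pos _).le,
            ← Real.exp_add]
          calc ∫⁻ v, kf (u + v - s) ∂F ≤ ∫⁻ v, 1 ∂F := lintegral_mono fun v => hk1 _
            _ = ENNReal.ofReal 1 := by simp
            _ ≤ _ := ENNReal.ofReal_le_ofReal (Real.one_le_exp (by linarith))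
        · rw [Set.indicator_of_notMem (by simpa using hu)]; exact zero_le
  · intro i j hij
    have : ∀ᵐ ω ∂μ, ω ∉ D i ∩ D j := by
      filter_upwards [ae_all_iff.2 hnn] with ω h1
      rintro ⟨⟨a1, a2, _⟩, b1, b2, _⟩
      rw [← Finset.sum_range_succ (fun i => ξ i ω)] at a2 b2
      rcases lt_or_gt_of_ne hij with h | h
      · have := ren_count_mono_set h1 (show i + 1 ≤ j from h)
        linarith
      · have := ren_count_mono_set h1 (show j + 1 ≤ i from h)
        linarith
    exact measure_eq_zero_iff_ae_notMem.2 this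

end single

section pooled
variable {Ω : Type*} [MeasurableSpace Ω] {μ : Measure Ω} [IsProbabilityMeasure μ]

lemma ren_ident (F : Measure ℝ) [IsProbabilityMeasure F] (hF : F (Set.Iio 0) = 0)
    (hF' : F (Set.Ioi 0) ≠ 0) (ξ : ℕ → Ω → ℝ) (hm : ∀ j, Measurable (ξ j))
    (hnn : ∀ j, ∀ᵐ ω ∂μ, 0 ≤ ξ j ω)
    (hind : iIndepFun ξ μ) (hlaw : ∀ j, μ.map (ξ (j+1)) = F) (h0 : μ.map (ξ 0) = renG F)
    (s t : ℝ) (hs : 0 ≤ s) (ht : 0 ≤ t) :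
    IdentDistrib
      (fun ω => renewalCount (fun j => ξ j ω) (s + t) - renewalCount (fun j => ξ j ω) s)
      (fun ω => renewalCount (fun j => ξ j ω) t) μ μ := by
  have hN : ∀ t, Measurable (fun ω => renewalCount (fun j => ξ j ω) t) := fun t =>
    (ren_count_meas t).comp (measurable_pi_lambda _ hm)
  have hNs : ∀ s, Measurable
      (fun ω => renewalCount (fun j => ξ j ω) (s + t) - renewalCount (fun j => ξ j ω) s) := by
    intro s
    exact (hN _).sub (hN _)
  have key : IdentDistrib
      (fun ω => renewalCount (fun j => ξ j ω) (s + t) - renewalCount (fun j => ξ j ω) s)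
      (fun ω => renewalCount (fun j => ξ j ω) (0 + t) - renewalCount (fun j => ξ j ω) 0) μ μ := by
    refine ⟨(hNs s).aemeasurable, (hNs 0).aemeasurable, ?_⟩
    have := Measure.isProbabilityMeasure_map (μ := μ) (hNs s).aemeasurable
    have := Measure.isProbabilityMeasure_map (μ := μ) (hNs 0).aemeasurable
    refine Measure.ext_of_Ici _ _ fun m => ?_
    rw [Measure.map_apply (hNs s) measurableSet_Ici, Measure.map_apply (hNs 0) measurableSet_Ici]
    rcases m with _ | p
    · simp
    · exact (ren_incr_law F hF hF' ξ hm hnn hind hlaw h0 s t hs ht p).trans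
        (ren_incr_law F hF hF' ξ hm hnn hind hlaw h0 0 t le_rfl ht p).symm
  refine key.trans (IdentDistrib.of_ae_eq (hNs 0).aemeasurable ?_)
  have hpos : ∀ᵐ ω ∂μ, 0 < ξ 0 ω := by
    have : μ.map (ξ 0) (Set.Iic 0) = 0 := by
      rw [h0, renG]
      refine withDensity_absolutelyContinuous _ _ ?_
      rw [renL, Measure.restrict_apply measurableSet_Iic, Set.Iic_inter_Ioi, Set.Ioc_self,
        measure_empty]
    rw [Measure.map_apply (hm 0) measurableSet_Iic] at this
    rw [ae_iff]
    simpa [Set.preimage, Set.Iic] using this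
  filter_upwards [hpos, ae_all_iff.2 hnn, ren_bdd F hF hF' ξ hm hind hlaw h0] with ω h1 h2 h3
  have : renewalCount (fun j => ξ j ω) 0 = 0 := by
    by_contra hcon
    have := (ren_count_iff h2 le_rfl (h3 0) 1).1 (by omega)
    simp at this
    linarith
  rw [this, zero_add, Nat.sub_zero]

lemma ren_rows (ξ : ℕ → ℕ → Ω → ℝ) (hm : ∀ i j, Measurable (ξ i j))
    (hind : iIndepFun (fun p : ℕ × ℕ => ξ p.1 p.2) μ) :
    iIndepFun (fun i ω => fun j => ξ i j ω) μ := by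
  have : ∀ i j, IsProbabilityMeasure (μ.map (ξ i j)) :=
    fun i j => Measure.isProbabilityMeasure_map (hm i j).aemeasurable
  have h1 := (iIndepFun_iff_map_fun_eq_infinitePi_map (fun p : ℕ × ℕ => hm p.1 p.2)).1 hind
  rw [iIndepFun_iff_map_fun_eq_infinitePi_map (by fun_prop)]
  have h2 : ∀ i, iIndepFun (ξ i) μ := fun i =>
    hind.precomp (g := fun j => (i, j)) (fun a b h => by simpa using h)
  have e : ∀ i, μ.map (fun ω j => ξ i j ω) = Measure.infinitePi (fun j => μ.map (ξ i j)) :=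
    fun i => (iIndepFun_iff_map_fun_eq_infinitePi_map (hm i)).1 (h2 i)
  simp_rw [e]
  rw [← Measure.infinitePi_map_curry (fun i j => μ.map (ξ i j)), ← h1,
    Measure.map_map (by fun_prop) (by fun_prop)]
  rfl

lemma ren_law0 (S : Ω → ℝ) (hSmeas : Measurable S) (hSnn : ∀ᵐ ω ∂μ, 0 ≤ S ω)
    (hES : ∫ ω, S ω ∂μ = 1) (X : Ω → ℝ) (hX : Measurable X) (hXnn : ∀ᵐ ω ∂μ, 0 ≤ X ω)
    (heq : ∀ y : ℝ, 0 ≤ y →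
      (μ {ω | y < X ω}).toReal = ∫ z in Set.Ioi y, (μ {ω | z < S ω}).toReal) :
    μ.map X = renG (μ.map S) := by
  have hp := Measure.isProbabilityMeasure_map (μ := μ) hX.aemeasurable
  have hSint : Integrable S μ := by
    by_contra hcon
    rw [integral_undef hcon] at hES
    norm_num at hES
  have hlin : ∫⁻ z in Set.Ioi 0, μ {ω | z < S ω} = 1 := by
    rw [← lintegral_eq_lintegral_meas_lt μ hSnn hSmeas.aemeasurable,
      ← ofReal_integral_eq_lintegral_ofReal hSint hSnn, hES, ENNReal.ofReal_one]
  have hmz : Measurable fun z => μ {ω | z < S ω} :=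
    Antitone.measurable fun a b h => measure_mono fun ω hω => lt_of_le_of_lt h hω
  have htail : ∀ y, renG (μ.map S) (Set.Ioi y)
      = ∫⁻ z in Set.Ioi (max y 0), μ {ω | z < S ω} := by
    intro y
    rw [renG, withDensity_apply _ measurableSet_Ioi, renL,
      Measure.restrict_restrict measurableSet_Ioi, Set.Ioi_inter_Ioi]
    refine lintegral_congr fun z => ?_
    rw [Measure.map_apply hSmeas measurableSet_Ioi]; rfl
  have hmain : ∀ y, μ.map X (Set.Ioi y) = renG (μ.map S) (Set.Ioi y) := by
    have hpos : ∀ y, 0 ≤ y → μ.map X (Set.Ioi y) = renG (μ.map S) (Set.Ioi y) := by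
      intro y hy
      rw [htail, max_eq_left hy, Measure.map_apply hX measurableSet_Ioi]
      have h1 := heq y hy
      rw [integral_toReal hmz.aemeasurable (Filter.Eventually.of_forall fun z => measure_lt_top _ _),
        ENNReal.toReal_eq_toReal_iff' (measure_ne_top _ _)] at h1
      · exact h1
      · refine (lt_of_le_of_lt (lintegral_mono_set (Set.Ioi_subset_Ioi hy)) ?_).ne
        rw [hlin]; exact ENNReal.one_lt_top
    intro y
    rcases le_or_gt 0 y with hy | hy
    · exact hpos y hy
    · rw [htail, max_eq_right hy.le, hlin, Measure.map_apply hX measurableSet_Ioi]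
      have : X ⁻¹' Set.Ioi y =ᵐ[μ] Set.univ := by
        rw [Filter.eventuallyEq_set]
        filter_upwards [hXnn] with ω h
        simp only [Set.mem_preimage, Set.mem_Ioi, Set.mem_univ, iff_true]
        linarith
      rw [measure_congr this, measure_univ]
  have huniv : μ.map X Set.univ = renG (μ.map S) Set.univ := by
    have := hmain (-1)
    rw [htail, max_eq_right (by norm_num), hlin] at this
    rw [measure_univ, renG, withDensity_apply _ MeasurableSet.univ, Measure.restrict_univ, renL,
      ← hlin]
    refine (lintegral_congr fun z => ?_)
    rw [Measure.map_apply hSmeas measurableSet_Ioi]; rfl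
  refine Measure.ext_of_Iic _ _ fun a => ?_
  have hfin : IsFiniteMeasure (renG (μ.map S)) := ⟨by rw [← huniv]; exact measure_lt_top _ _⟩
  have c : Set.Iic a = (Set.Ioi a)ᶜ := by simp
  rw [c, measure_compl measurableSet_Ioi (measure_ne_top _ _),
    measure_compl measurableSet_Ioi (measure_ne_top _ _), huniv, hmain]

/-- The facts about the pooled process used in the chaining argument. -/
lemma ren_pooled (S : Ω → ℝ) (hSmeas : Measurable S) (hSnn : ∀ᵐ ω ∂μ, 0 ≤ S ω)
    (hES : ∫ ω, S ω ∂μ = 1)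
    (ξ : ℕ → ℕ → Ω → ℝ)
    (hξmeas : ∀ i j, Measurable (ξ i j))
    (hξnn : ∀ i j, ∀ᵐ ω ∂μ, 0 ≤ ξ i j ω)
    (hindep : iIndepFun (fun p : ℕ × ℕ => ξ p.1 p.2) μ)
    (hlaw : ∀ i j, μ.map (ξ i (j + 1)) = μ.map S)
    (heq : ∀ i, ∀ y : ℝ, 0 ≤ y →
      (μ {ω | y < ξ i 0 ω}).toReal = ∫ z in Set.Ioi y, (μ {ω | z < S ω}).toReal) (n : ℕ) :
    (∀ᵐ ω ∂μ, ∀ s t : ℝ, 0 ≤ s → s ≤ t →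
      (∑ i ∈ Finset.range n, (renewalCount (fun j => ξ i j ω) s : ℝ))
        ≤ ∑ i ∈ Finset.range n, (renewalCount (fun j => ξ i j ω) t : ℝ)) ∧
    (∀ t, Measurable
      fun ω => ∑ i ∈ Finset.range n, (renewalCount (fun j => ξ i j ω) t : ℝ)) ∧
    (∀ s t : ℝ, 0 ≤ s → 0 ≤ t → ∀ f : ℝ → ℝ≥0∞, Measurable f →
      ∫⁻ ω, f ((∑ i ∈ Finset.range n, (renewalCount (fun j => ξ i j ω) (s + t) : ℝ))
        - ∑ i ∈ Finset.range n, (renewalCount (fun j => ξ i j ω) s : ℝ)) ∂μ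
      = ∫⁻ ω, f (∑ i ∈ Finset.range n, (renewalCount (fun j => ξ i j ω) t : ℝ)) ∂μ) := by
  set F := μ.map S with hFdef
  have hp : IsProbabilityMeasure F := Measure.isProbabilityMeasure_map hSmeas.aemeasurable
  have hF : F (Set.Iio 0) = 0 := by
    rw [hFdef, Measure.map_apply hSmeas measurableSet_Iio]
    rw [ae_iff] at hSnn
    simpa [Set.preimage, Set.Iio] using hSnn
  have hF' : F (Set.Ioi 0) ≠ 0 := by
    intro hcon
    rw [hFdef, Measure.map_apply hSmeas measurableSet_Ioi] at hcon
    have h2 : S =ᵐ[μ] 0 := by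
      filter_upwards [hSnn, measure_eq_zero_iff_ae_notMem.1 hcon] with ω h1 h2
      simp at h2
      exact le_antisymm h2 h1
    rw [integral_congr_ae h2] at hES
    simp at hES
  have h0 : ∀ i, μ.map (ξ i 0) = renG F := fun i =>
    ren_law0 S hSmeas hSnn hES (ξ i 0) (hξmeas i 0) (hξnn i 0) (heq i)
  have hi : ∀ i, iIndepFun (ξ i) μ := fun i =>
    hindep.precomp (g := fun j => (i, j)) (fun a b h => by simpa using h)
  have hbdd : ∀ i, _ := fun i => ren_bdd F hF hF' (ξ i) (hξmeas i) (hi i) (hlaw i) (h0 i)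
  have hNm : ∀ i t, Measurable (fun ω => renewalCount (fun j => ξ i j ω) t) := fun i t =>
    (ren_count_meas t).comp (measurable_pi_lambda _ (hξmeas i))
  have hmono : ∀ᵐ ω ∂μ, ∀ s t : ℝ, 0 ≤ s → s ≤ t → ∀ i,
      renewalCount (fun j => ξ i j ω) s ≤ renewalCount (fun j => ξ i j ω) t := by
    filter_upwards [ae_all_iff.2 hbdd] with ω h s t hs hst i
    refine csSup_le_csSup (h i t) ⟨0, by simpa using hs⟩ fun n hn => le_trans hn hst
  refine ⟨?_, ?_, ?_⟩
  · filter_upwards [hmono] with ω h s t hs hst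
    exact Finset.sum_le_sum fun i _ => Nat.cast_le.2 (h s t hs hst i)
  · intro t
    refine Finset.measurable_fun_sum _ fun i _ => ?_
    exact measurable_from_top.comp (hNm i t)
  · intro s t hs ht f hf
    have hid := fun i => ren_ident F hF hF' (ξ i) (hξmeas i) (hξnn i) (hi i) (hlaw i) (h0 i)
      s t hs ht
    have hrows := ren_rows ξ hξmeas hindep
    have i1 := hrows.comp (fun _ x => renewalCount x (s + t) - renewalCount x s)
      (fun _ => (ren_count_meas _).sub (ren_count_meas _))
    have i2 := hrows.comp (fun _ x => renewalCount x t) (fun _ => ren_count_meas _)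
    have hpi := IdentDistrib.pi hid i1 i2
    have hmeas : Measurable fun x : ℕ → ℕ => f (∑ i ∈ Finset.range n, (x i : ℝ)) := by
      refine hf.comp (Finset.measurable_fun_sum _ fun i _ => ?_)
      exact measurable_from_top.comp (measurable_pi_apply i)
    have h1 := (hpi.comp hmeas).lintegral_eq
    simp only [Function.comp_def] at h1
    rw [← h1]
    refine lintegral_congr_ae ?_
    filter_upwards [hmono] with ω h
    rw [← Finset.sum_sub_distrib]
    congr 1
    refine Finset.sum_congr rfl fun i _ => ?_
    rw [Nat.cast_sub (h s (s+t) hs (by linarith) i)]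

end pooled

lemma chain_grid (f : ℝ → ℝ) (T : ℝ) (x : ℕ → ℝ) (hx : ∀ l, 0 ≤ x l) (J : ℕ) (hf0 : f 0 ≤ 0)
    (hinc : ∀ l < J, ∀ i : ℕ, i < 2 ^ l → f (2 * i * (T / 2 ^ (l+1)) + T / 2 ^ (l+1))
      - f (2 * i * (T / 2 ^ (l+1))) ≤ x l) :
    ∀ j ≤ J, ∀ m : ℕ, m < 2 ^ j → f (m * (T / 2 ^ j)) ≤ ∑ l ∈ Finset.range j, x l := by
  intro j
  induction j with
  | zero =>
    intro _ m hm
    have : m = 0 := by simpa using hm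
    subst this
    simpa using hf0
  | succ j ih =>
    intro hj m hm
    rw [Finset.sum_range_succ]
    obtain ⟨i, hi⟩ := Nat.even_or_odd' m
    have hi2 : i < 2 ^ j := by rw [pow_succ] at hm; omega
    have h1 := ih (by omega) i hi2
    have e : (i : ℝ) * (T / 2 ^ j) = 2 * i * (T / 2 ^ (j+1)) := by
      rw [pow_succ]; field_simp
    rw [e] at h1
    rcases hi with rfl | rfl
    · push_cast
      linarith [hx j]
    · have h2 := hinc j (by omega) i hi2
      have e2 : ((2 * i + 1 : ℕ) : ℝ) * (T / 2 ^ (j+1))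
          = 2 * i * (T / 2 ^ (j+1)) + T / 2 ^ (j+1) := by push_cast; ring
      rw [e2]
      linarith

lemma chain_path (f : ℝ → ℝ) (n T : ℝ) (hT : 0 < T) (x : ℕ → ℝ) (hx : ∀ l, 0 ≤ x l) (J : ℕ)
    (hn : 0 ≤ n)
    (hf0 : f 0 ≤ 0) (hf : ∀ s t, 0 ≤ s → s ≤ t → f t ≤ f s + n * (t - s))
    (hinc : ∀ l < J, ∀ i : ℕ, i < 2 ^ l → f (2 * i * (T / 2 ^ (l+1)) + T / 2 ^ (l+1))
      - f (2 * i * (T / 2 ^ (l+1))) ≤ x l) (t : ℝ) (ht : 0 ≤ t) (htT : t < T) :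
    f t ≤ ∑ l ∈ Finset.range J, x l + n * T / 2 ^ J := by
  have hh : 0 < T / 2 ^ J := by positivity
  set m := ⌊t / (T / 2 ^ J)⌋₊ with hm
  have h1 : (m : ℝ) * (T / 2 ^ J) ≤ t := by
    rw [← le_div_iff₀ hh]; exact Nat.floor_le (by positivity)
  have h2 : t < (m + 1 : ℝ) * (T / 2 ^ J) := by
    rw [← div_lt_iff₀ hh]; exact Nat.lt_floor_add_one _
  have h3 : m < 2 ^ J := by
    have : (m : ℝ) * (T / 2 ^ J) < 2 ^ J * (T / 2 ^ J) := by
      refine lt_of_le_of_lt h1 ?_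
      rw [mul_div_cancel₀ _ (by positivity)]; exact htT
    have := lt_of_mul_lt_mul_right this hh.le
    exact_mod_cast this
  have h4 := chain_grid f T x hx J hf0 hinc J le_rfl m h3
  have h5 := hf _ t (by positivity) h1
  have h6 : n * (t - m * (T / 2 ^ J)) ≤ n * (T / 2 ^ J) :=
    mul_le_mul_of_nonneg_left (by linarith) hn
  have e : n * T / 2 ^ J = n * (T / 2 ^ J) := by ring
  rw [e]
  linarith

/-- the ratio `2^{-b}`. -/
noncomputable def chq (b : ℝ) : ℝ := Real.exp (-(b * Real.log 2))

lemma chq_pos (b : ℝ) : 0 < chq b := Real.exp_pos _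

lemma chq_lt_one {b : ℝ} (hb : 0 < b) : chq b < 1 := by
  unfold chq
  rw [Real.exp_lt_one_iff]
  have := Real.log_pos (show (1:ℝ) < 2 by norm_num)
  nlinarith [mul_pos hb this]

lemma chq_inv {b : ℝ} (hb : 0 < b) : 1 / (1 - chq b) ≤ 1 + 2 / b := by
  have hl : (1:ℝ)/2 < Real.log 2 := by linarith [Real.log_two_gt_d9]
  have h1 : 1 - chq b > 0 := by linarith [chq_lt_one hb]
  have h2 : chq b * (1 + b * Real.log 2) ≤ 1 := by
    have := Real.add_one_le_exp (b * Real.log 2)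
    calc chq b * (1 + b * Real.log 2) ≤ chq b * Real.exp (b * Real.log 2) :=
          mul_le_mul_of_nonneg_left (by linarith) (chq_pos b).le
      _ = 1 := by unfold chq; rw [← Real.exp_add]; simp
  have h3 : chq b * (1 + b / 2) ≤ 1 := by
    refine le_trans (mul_le_mul_of_nonneg_left ?_ (chq_pos b).le) h2
    nlinarith
  rw [div_le_iff₀ h1]
  have e : (1 + 2 / b) * (1 - chq b) - 1 = (2 / b) * (1 - chq b * (1 + b / 2)) := by
    field_simp; ring
  have : 0 ≤ (2 / b) * (1 - chq b * (1 + b / 2)) := mul_nonneg (by positivity) (by linarith)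
  linarith

/-- the chaining weight exponent. -/
noncomputable def cha (σ ρ : ℝ) : ℝ := (σ - 1) / (2 * ρ)

lemma cha_pos {σ ρ : ℝ} (h1 : 1 < σ) (h2 : σ < ρ) : 0 < cha σ ρ :=
  div_pos (by linarith) (by linarith)

noncomputable def chw (σ ρ : ℝ) (l : ℕ) : ℝ := (1 - chq (cha σ ρ)) * chq (cha σ ρ) ^ l

lemma chw_pos {σ ρ : ℝ} (h1 : 1 < σ) (h2 : σ < ρ) (l : ℕ) : 0 < chw σ ρ l :=
  mul_pos (by linarith [chq_lt_one (cha_pos h1 h2)]) (pow_pos (chq_pos _) _)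

lemma chw_sum {σ ρ : ℝ} (J : ℕ) : ∑ l ∈ Finset.range J, chw σ ρ l ≤ 1 := by
  unfold chw
  rw [← Finset.mul_sum, mul_neg_geom_sum]
  linarith [pow_pos (chq_pos (cha σ ρ)) J]

noncomputable def chQ (D T lam σ ρ : ℝ) : ℝ :=
  D * T ^ σ * lam ^ (-ρ) * (8 / (1 - chq (cha σ ρ))) ^ ρ

lemma ch_term {D T lam σ ρ y : ℝ} (hD : 0 ≤ D) (hT : 0 < T) (hlam : 0 < lam)
    (h1 : 1 < σ) (h2 : σ < ρ) (k l : ℕ) (hy : lam * 2 ^ k * chw σ ρ l / 8 ≤ y) :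
    2 ^ l * (D * (T * 2 ^ k / 2 ^ (l+1)) ^ σ * y ^ (-ρ))
      ≤ chQ D T lam σ ρ * chq (ρ - σ) ^ k * chq ((σ - 1) / 2) ^ l := by
  have hw := chw_pos h1 h2 l
  have hy0 : 0 < lam * 2 ^ k * chw σ ρ l / 8 := by positivity
  have hu : 0 < 1 - chq (cha σ ρ) := by linarith [chq_lt_one (cha_pos h1 h2)]
  have s1 : y ^ (-ρ) ≤ (lam * 2 ^ k * chw σ ρ l / 8) ^ (-ρ) :=
    Real.rpow_le_rpow_of_nonpos hy0 hy (by linarith)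
  have hθ := Real.log_pos (show (1:ℝ) < 2 by norm_num)
  set θ := Real.log 2 with hθd
  have e2 : ∀ m : ℕ, (2:ℝ) ^ m = Real.exp (m * θ) := by
    intro m; rw [Real.exp_nat_mul, hθd, Real.exp_log (by norm_num)]
  have ea : (T * 2 ^ k / 2 ^ (l+1)) ^ σ
      = Real.exp ((Real.log T + k * θ - (l + 1) * θ) * σ) := by
    rw [Real.rpow_def_of_pos (by positivity), Real.log_div (by positivity) (by positivity),
      Real.log_mul (by positivity) (by positivity), Real.log_pow, Real.log_pow]
    push_cast; rfl
  have eb : (lam * 2 ^ k * chw σ ρ l / 8) ^ (-ρ)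
      = Real.exp ((Real.log lam + k * θ + (Real.log (1 - chq (cha σ ρ)) - l * (cha σ ρ * θ))
          - Real.log 8) * (-ρ)) := by
    rw [Real.rpow_def_of_pos hy0, Real.log_div (by positivity) (by positivity),
      Real.log_mul (by positivity) (by positivity), Real.log_mul (by positivity) (by positivity),
      Real.log_pow]
    have : Real.log (chw σ ρ l) = Real.log (1 - chq (cha σ ρ)) - l * (cha σ ρ * θ) := by
      unfold chw
      rw [Real.log_mul hu.ne' (pow_pos (chq_pos _) _).ne', Real.log_pow]
      have : Real.log (chq (cha σ ρ)) = -(cha σ ρ * θ) := by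
        unfold chq; rw [Real.log_exp]
      rw [this]; ring
    rw [this]
  have ec : (8 / (1 - chq (cha σ ρ))) ^ ρ
      = Real.exp ((Real.log 8 - Real.log (1 - chq (cha σ ρ))) * ρ) := by
    rw [Real.rpow_def_of_pos (by positivity), Real.log_div (by positivity) hu.ne']
  have ed : chq (ρ - σ) ^ k = Real.exp (k * (-((ρ - σ) * θ))) := by
    unfold chq; rw [← Real.exp_nat_mul]
  have ee : chq ((σ - 1) / 2) ^ l = Real.exp (l * (-((σ - 1) / 2 * θ))) := by
    unfold chq; rw [← Real.exp_nat_mul]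
  have eρ : cha σ ρ * ρ = (σ - 1) / 2 := by
    unfold cha
    have : ρ ≠ 0 := by linarith
    field_simp
  calc 2 ^ l * (D * (T * 2 ^ k / 2 ^ (l+1)) ^ σ * y ^ (-ρ))
      ≤ 2 ^ l * (D * (T * 2 ^ k / 2 ^ (l+1)) ^ σ * (lam * 2 ^ k * chw σ ρ l / 8) ^ (-ρ)) := by
        gcongr
    _ ≤ chQ D T lam σ ρ * chq (ρ - σ) ^ k * chq ((σ - 1) / 2) ^ l := by
        unfold chQ
        rw [ea, eb, ec, ed, ee, e2 l, Real.rpow_def_of_pos hT, Real.rpow_def_of_pos hlam]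
        have L : ∀ a b c : ℝ, Real.exp a * (D * Real.exp b * Real.exp c)
            = D * Real.exp (a + b + c) := by
          intro a b c; rw [Real.exp_add, Real.exp_add]; ring
        have R : ∀ a b c d e : ℝ, D * Real.exp a * Real.exp b * Real.exp c * Real.exp d
            * Real.exp e = D * Real.exp (a + b + c + d + e) := by
          intro a b c d e; simp only [Real.exp_add]; ring
        rw [L, R]
        refine mul_le_mul_of_nonneg_left (Real.exp_le_exp.2 ?_) hD
        have : (l:ℝ) * (cha σ ρ * θ) * ρ = l * ((σ - 1) / 2) * θ := by
          rw [← eρ]; ring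
        nlinarith [mul_pos hθ (show 0 < σ by linarith)]

lemma ch_geom {q : ℝ} (h0 : 0 ≤ q) (h1 : q < 1) (J : ℕ) :
    ∑ l ∈ Finset.range J, q ^ l ≤ 1 / (1 - q) := by
  rw [le_div_iff₀ (by linarith), geom_sum_mul_neg]
  linarith [pow_nonneg h0 J]

theorem chain_main {Ω : Type*} [MeasurableSpace Ω] {μ : Measure Ω} [IsProbabilityMeasure μ]
    (A : ℝ → Ω → ℝ) (hA0 : ∀ t ω, 0 ≤ A t ω)
    (hmono : ∀ᵐ ω ∂μ, ∀ s t, 0 ≤ s → s ≤ t → A s ω ≤ A t ω)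
    (n ν lam : ℝ) (hν : 0 < ν) (hνn : ν < n) (hlam : 8 ≤ lam)
    (D1 σ1 ρ1 D2 σ2 ρ2 : ℝ) (hD1 : 0 ≤ D1) (hD2 : 0 ≤ D2) (h11 : 1 < σ1) (h12 : σ1 < ρ1)
    (h21 : 1 < σ2) (h22 : σ2 < ρ2)
    (htail : ∀ s h y, 0 ≤ s → 0 < h → 1 ≤ n * h → 0 < y →
      μ {ω | y ≤ |A (s+h) ω - A s ω - n * h|}
        ≤ ENNReal.ofReal (D1 * h ^ σ1 * y ^ (-ρ1) + D2 * h ^ σ2 * y ^ (-ρ2))) :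
    μ {ω | ∃ t, 0 ≤ t ∧ lam / 2 < n * t - A t ω - ν * t} ≤ ENNReal.ofReal
      (chQ D1 (lam / ν) lam σ1 ρ1 * (1 / (1 - chq ((σ1 - 1) / 2))) * (1 / (1 - chq (ρ1 - σ1)))
      + chQ D2 (lam / ν) lam σ2 ρ2 * (1 / (1 - chq ((σ2 - 1) / 2)))
        * (1 / (1 - chq (ρ2 - σ2)))) := by
  have hlam0 : 0 < lam := by linarith
  have hn : 0 < n := by linarith
  set T := lam / ν with hTd
  have hT : 0 < T := by positivity
  have hTν : ν * T = lam := by rw [hTd]; field_simp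
  have hnT : 1 ≤ n * T := by nlinarith
  have hJ : ∀ k : ℕ, ∃ J : ℕ, (2:ℝ) ^ J ≤ n * (T * 2 ^ k) ∧ n * (T * 2 ^ k) < 2 ^ (J + 1) := by
    intro k
    refine exists_nat_pow_near ?_ (by norm_num)
    have : (1:ℝ) ≤ 2 ^ k := one_le_pow₀ (by norm_num)
    nlinarith
  choose J hJ1 hJ2 using hJ
  set y : ℕ → ℕ → ℝ := fun k l => lam * 2 ^ k / 4 * ((chw σ1 ρ1 l + chw σ2 ρ2 l) / 2) with hy
  have hy0 : ∀ k l, 0 < y k l := fun k l => by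
    have := chw_pos h11 h12 l
    have := chw_pos h21 h22 l
    simp only [hy]; positivity
  set Bad : ℕ → ℕ → ℕ → Set Ω := fun k l i =>
    {ω | y k l ≤ |A (2 * i * (T * 2 ^ k / 2 ^ (l+1)) + T * 2 ^ k / 2 ^ (l+1)) ω
      - A (2 * i * (T * 2 ^ k / 2 ^ (l+1))) ω - n * (T * 2 ^ k / 2 ^ (l+1))|} with hBad
  set BadK : ℕ → Set Ω := fun k => ⋃ l ∈ Finset.range (J k), ⋃ i ∈ Finset.range (2 ^ l), Bad k l i
    with hBadK
  -- pathwise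
  have hsub : {ω | ∃ t, 0 ≤ t ∧ lam / 2 < n * t - A t ω - ν * t} ≤ᵐ[μ] ⋃ k, BadK k := by
    filter_upwards [hmono] with ω hω
    rintro ⟨t, ht, hlt⟩
    by_contra hcon
    have hnb : ∀ k, ∀ l < J k, ∀ i < 2 ^ l, ω ∉ Bad k l i := by
      intro k l hl i hi hmem
      apply hcon
      refine Set.mem_iUnion.2 ⟨k, ?_⟩
      simp only [hBadK, Set.mem_iUnion, Finset.mem_range]
      exact ⟨l, hl, i, hi, hmem⟩
    have hpath : ∀ k : ℕ, t < T * 2 ^ k → n * t - A t ω ≤ lam * 2 ^ k / 2 := by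
      intro k hk
      have h2k : (1:ℝ) ≤ 2 ^ k := one_le_pow₀ (by norm_num)
      have := chain_path (fun t => n * t - A t ω) n (T * 2 ^ k) (by positivity) (y k)
        (fun l => (hy0 k l).le) (J k) hn.le (by simpa using hA0 0 ω)
        (fun s t hs hst => by have := hω s t hs hst; linarith)
        (fun l hl i hi => by
          have := hnb k l hl i hi
          simp only [hBad, Set.mem_ofPred_eq, not_le] at this
          have := (abs_lt.1 this).1
          linarith) t ht hk
      have s1 : ∑ l ∈ Finset.range (J k), y k l ≤ lam * 2 ^ k / 4 := by
        simp only [hy]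
        rw [← Finset.mul_sum, ← Finset.sum_div, Finset.sum_add_distrib]
        have := chw_sum (σ := σ1) (ρ := ρ1) (J k)
        have := chw_sum (σ := σ2) (ρ := ρ2) (J k)
        have h0 : 0 ≤ lam * 2 ^ k / 4 := by positivity
        nlinarith
      have s2 : n * (T * 2 ^ k) / 2 ^ J k ≤ 2 := by
        rw [div_le_iff₀ (by positivity)]
        have := hJ2 k
        rw [pow_succ] at this
        linarith
      nlinarith
    rcases lt_or_ge t T with h | h
    · have := hpath 0 (by simpa using h)
      simp at this
      have : 0 ≤ ν * t := by positivity
      linarith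
    · obtain ⟨m, hm1, hm2⟩ := exists_nat_pow_near (x := t / T) (y := (2:ℝ))
        ((one_le_div hT).2 h) (by norm_num)
      rw [le_div_iff₀ hT] at hm1
      rw [div_lt_iff₀ hT] at hm2
      have h1 := hpath (m+1) (by linarith)
      have h2 : lam * 2 ^ m ≤ ν * t := by
        calc lam * 2 ^ m = ν * (2 ^ m * T) := by rw [← hTν]; ring
          _ ≤ ν * t := by gcongr
      rw [pow_succ] at h1
      linarith
  refine (measure_mono_ae hsub).trans ((measure_iUnion_le _).trans ?_)
  set β1 := chq ((σ1 - 1) / 2)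
  set β2 := chq ((σ2 - 1) / 2)
  set α1 := chq (ρ1 - σ1)
  set α2 := chq (ρ2 - σ2)
  set Q1 := chQ D1 T lam σ1 ρ1 with hQ1d
  set Q2 := chQ D2 T lam σ2 ρ2 with hQ2d
  have hα1 : α1 < 1 := chq_lt_one (by linarith)
  have hα2 : α2 < 1 := chq_lt_one (by linarith)
  have hβ1 : β1 < 1 := chq_lt_one (by linarith)
  have hβ2 : β2 < 1 := chq_lt_one (by linarith)
  have hα1' : 0 < α1 := chq_pos _
  have hα2' : 0 < α2 := chq_pos _
  have hβ1' : 0 < β1 := chq_pos _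
  have hβ2' : 0 < β2 := chq_pos _
  have hQ1 : 0 ≤ Q1 := by
    have := chq_lt_one (cha_pos h11 h12)
    have : 0 < 1 - chq (cha σ1 ρ1) := by linarith
    rw [hQ1d]; unfold chQ; positivity
  have hQ2 : 0 ≤ Q2 := by
    have := chq_lt_one (cha_pos h21 h22)
    have : 0 < 1 - chq (cha σ2 ρ2) := by linarith
    rw [hQ2d]; unfold chQ; positivity
  have hlev : ∀ k, ∀ l < J k, μ (⋃ i ∈ Finset.range (2 ^ l), Bad k l i)
      ≤ ENNReal.ofReal (Q1 * α1 ^ k * β1 ^ l + Q2 * α2 ^ k * β2 ^ l) := by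
    intro k l hl
    have hhn : 1 ≤ n * (T * 2 ^ k / 2 ^ (l+1)) := by
      rw [← mul_div_assoc, le_div_iff₀ (by positivity), one_mul]
      exact (pow_le_pow_right₀ (by norm_num) hl).trans (hJ1 k)
    have hone : ∀ i ∈ Finset.range (2 ^ l), μ (Bad k l i) ≤ ENNReal.ofReal
        (D1 * (T * 2 ^ k / 2 ^ (l+1)) ^ σ1 * (y k l) ^ (-ρ1)
          + D2 * (T * 2 ^ k / 2 ^ (l+1)) ^ σ2 * (y k l) ^ (-ρ2)) := fun i _ =>
      htail _ _ _ (by positivity) (by positivity) hhn (hy0 k l)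
    refine (measure_biUnion_finset_le _ _).trans ((Finset.sum_le_sum hone).trans ?_)
    rw [Finset.sum_const, Finset.card_range, nsmul_eq_mul]
    rw [show ((2 ^ l : ℕ) : ℝ≥0∞) = ENNReal.ofReal (2 ^ l) by
      rw [← ENNReal.ofReal_natCast]; push_cast; rfl, ← ENNReal.ofReal_mul (by positivity)]
    refine ENNReal.ofReal_le_ofReal ?_
    rw [mul_add]
    have w1 := chw_pos h11 h12 l
    have w2 := chw_pos h21 h22 l
    have hl2 : 0 < lam * 2 ^ k := by positivity
    refine add_le_add (ch_term hD1 hT hlam0 h11 h12 k l ?_) (ch_term hD2 hT hlam0 h21 h22 k l ?_)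
    · simp only [hy]
      nlinarith [mul_pos hl2 w2]
    · simp only [hy]
      nlinarith [mul_pos hl2 w1]
  have hK : ∀ k, μ (BadK k) ≤ ENNReal.ofReal
      (Q1 * (1 / (1 - β1)) * α1 ^ k + Q2 * (1 / (1 - β2)) * α2 ^ k) := by
    intro k
    refine (measure_biUnion_finset_le _ _).trans
      ((Finset.sum_le_sum fun l hl => hlev k l (Finset.mem_range.1 hl)).trans ?_)
    rw [← ENNReal.ofReal_sum_of_nonneg (fun l _ => by positivity)]
    refine ENNReal.ofReal_le_ofReal ?_
    rw [Finset.sum_add_distrib, ← Finset.mul_sum, ← Finset.mul_sum]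
    have g1 := mul_le_mul_of_nonneg_left (ch_geom hβ1'.le hβ1 (J k))
      (show 0 ≤ Q1 * α1 ^ k by positivity)
    have g2 := mul_le_mul_of_nonneg_left (ch_geom hβ2'.le hβ2 (J k))
      (show 0 ≤ Q2 * α2 ^ k by positivity)
    linarith
  refine (ENNReal.tsum_le_tsum hK).trans ?_
  have u1 : 0 ≤ 1 / (1 - β1) := by
    have : 0 < 1 - β1 := by linarith
    positivity
  have u2 : 0 ≤ 1 / (1 - β2) := by
    have : 0 < 1 - β2 := by linarith
    positivity
  have hs : HasSum (fun k => Q1 * (1 / (1 - β1)) * α1 ^ k + Q2 * (1 / (1 - β2)) * α2 ^ k)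
      (Q1 * (1 / (1 - β1)) * (1 / (1 - α1)) + Q2 * (1 / (1 - β2)) * (1 / (1 - α2))) := by
    rw [one_div (1 - α1), one_div (1 - α2)]
    exact ((hasSum_geometric_of_lt_one hα1'.le hα1).mul_left _).add
      ((hasSum_geometric_of_lt_one hα2'.le hα2).mul_left _)
  rw [← ENNReal.ofReal_tsum_of_nonneg (fun k => by positivity) hs.summable, hs.tsum_eq]

lemma ch_const {D ν lam σ ρ b P : ℝ} (hD : 0 ≤ D) (hν : 0 < ν) (hlam : 0 < lam)
    (h1 : 1 < σ) (h2 : σ < ρ) (hb1 : 1 ≤ b) (hb2 : 40 * ρ / (σ - 1) ≤ b)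
    (hb3 : 1 + 4 / (σ - 1) ≤ b) (hb4 : 1 + 2 / (ρ - σ) ≤ b) (hP : ρ + 2 ≤ P) :
    chQ D (lam / ν) lam σ ρ * (1 / (1 - chq ((σ - 1) / 2))) * (1 / (1 - chq (ρ - σ)))
      ≤ b ^ P * (D * ν ^ (-σ) * lam ^ (-(ρ - σ))) := by
  have hb0 : 0 < b := by linarith
  have hσ : 0 < σ - 1 := by linarith
  have hρ : 0 < ρ := by linarith
  have c0 := cha_pos h1 h2
  have k1 : 8 / (1 - chq (cha σ ρ)) ≤ b := by
    have h := chq_inv c0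
    have e : 2 / cha σ ρ = 4 * ρ / (σ - 1) := by
      unfold cha; field_simp; norm_num
    have e2 : 8 / (1 - chq (cha σ ρ)) = 8 * (1 / (1 - chq (cha σ ρ))) := by ring
    have e3 : 1 ≤ ρ / (σ - 1) := by rw [le_div_iff₀ hσ]; linarith
    have e4 : 4 * ρ / (σ - 1) = 4 * (ρ / (σ - 1)) := by ring
    have e5 : 40 * ρ / (σ - 1) = 40 * (ρ / (σ - 1)) := by ring
    rw [e2]
    rw [e, e4] at h
    rw [e5] at hb2
    linarith
  have k2 : 1 / (1 - chq ((σ - 1) / 2)) ≤ b := by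
    refine (chq_inv (by linarith)).trans (le_trans (le_of_eq ?_) hb3)
    field_simp; norm_num
  have k3 : 1 / (1 - chq (ρ - σ)) ≤ b := (chq_inv (by linarith)).trans hb4
  have p1 : 0 < 1 - chq (cha σ ρ) := by linarith [chq_lt_one c0]
  have p2 : 0 < 1 - chq ((σ - 1) / 2) := by
    linarith [chq_lt_one (show 0 < (σ - 1) / 2 by linarith)]
  have p3 : 0 < 1 - chq (ρ - σ) := by linarith [chq_lt_one (show 0 < ρ - σ by linarith)]
  have k4 : (8 / (1 - chq (cha σ ρ))) ^ ρ ≤ b ^ ρ :=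
    Real.rpow_le_rpow (by positivity) k1 hρ.le
  have eT : (lam / ν) ^ σ * lam ^ (-ρ) = ν ^ (-σ) * lam ^ (-(ρ - σ)) := by
    rw [Real.div_rpow hlam.le hν.le, Real.rpow_neg hν.le,
      show -(ρ - σ) = σ + -ρ by ring, Real.rpow_add hlam]
    ring
  have eP : b ^ ρ * b * b ≤ b ^ P := by
    have : b ^ ρ * b * b = b ^ (ρ + 2) := by
      rw [Real.rpow_add hb0, Real.rpow_two]; ring
    rw [this]
    exact Real.rpow_le_rpow_of_exponent_le hb1 hP
  unfold chQ
  rw [mul_assoc D, eT]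
  have hX : 0 ≤ D * (ν ^ (-σ) * lam ^ (-(ρ - σ))) := by positivity
  calc D * (ν ^ (-σ) * lam ^ (-(ρ - σ))) * (8 / (1 - chq (cha σ ρ))) ^ ρ
        * (1 / (1 - chq ((σ - 1) / 2))) * (1 / (1 - chq (ρ - σ)))
      ≤ D * (ν ^ (-σ) * lam ^ (-(ρ - σ))) * b ^ ρ * b * b := by gcongr
    _ = (b ^ ρ * b * b) * (D * (ν ^ (-σ) * lam ^ (-(ρ - σ)))) := by ring
    _ ≤ b ^ P * (D * (ν ^ (-σ) * lam ^ (-(ρ - σ)))) := mul_le_mul_of_nonneg_right eP hX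
    _ = _ := by ring

lemma ch_b {s₁ r₁ r₂ : ℝ} (hs₁ : 1 < s₁) (hr₁ : s₁ < r₁) (hr₂ : 2 < r₂) :
    400 * (r₁ + r₂) / (s₁ - 1) ≤ 100 * (r₁ + r₂) ^ 3 / ((s₁ - 1) * (r₁ - s₁) * (r₂ - 2)) ∧
    400 * (r₁ + r₂) / (r₁ - s₁) ≤ 100 * (r₁ + r₂) ^ 3 / ((s₁ - 1) * (r₁ - s₁) * (r₂ - 2)) ∧
    400 * (r₁ + r₂) / (r₂ - 2) ≤ 100 * (r₁ + r₂) ^ 3 / ((s₁ - 1) * (r₁ - s₁) * (r₂ - 2)) := by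
  have key : ∀ x y z R : ℝ, 0 < x → 0 < y → 0 < z → x + y ≤ R →
      400 * R / z ≤ 100 * R ^ 3 / (x * y * z) := by
    intro x y z R hx hy hz h
    rw [div_le_div_iff₀ hz (by positivity)]
    have h4 : 4 * (x * y) ≤ R ^ 2 := by nlinarith [sq_nonneg (x - y)]
    have : 0 ≤ 100 * R * z := by
      have : 0 ≤ R := by linarith
      positivity
    nlinarith [mul_le_mul_of_nonneg_left h4 this]
  refine ⟨?_, ?_, ?_⟩
  · rw [show (s₁ - 1) * (r₁ - s₁) * (r₂ - 2) = (r₁ - s₁) * (r₂ - 2) * (s₁ - 1) by ring]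
    exact key _ _ _ _ (by linarith) (by linarith) (by linarith) (by linarith)
  · rw [show (s₁ - 1) * (r₁ - s₁) * (r₂ - 2) = (s₁ - 1) * (r₂ - 2) * (r₁ - s₁) by ring]
    exact key _ _ _ _ (by linarith) (by linarith) (by linarith) (by linarith)
  · exact key _ _ _ _ (by linarith) (by linarith) (by linarith) (by linarith)

lemma ch_markov {Ω : Type*} [MeasurableSpace Ω] {μ : Measure Ω} {X : Ω → ℝ} (hX : Measurable X)
    {r K y : ℝ} (hr : 0 < r) (hy : 0 < y)
    (h : ∫⁻ ω, ENNReal.ofReal (|X ω| ^ r) ∂μ ≤ ENNReal.ofReal K) :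
    μ {ω | y ≤ |X ω|} ≤ ENNReal.ofReal (K * y ^ (-r)) := by
  have hyr : 0 < y ^ r := Real.rpow_pos_of_pos hy r
  have hm : Measurable fun ω => ENNReal.ofReal (|X ω| ^ r) :=
    ENNReal.measurable_ofReal.comp ((continuous_abs.measurable.comp hX).pow_const r)
  have h1 := meas_ge_le_lintegral_div (μ := μ) hm.aemeasurable (ε := ENNReal.ofReal (y ^ r))
    (by simpa using hyr) ENNReal.ofReal_ne_top
  have hsub : {ω | y ≤ |X ω|} ⊆ {ω | ENNReal.ofReal (y ^ r) ≤ ENNReal.ofReal (|X ω| ^ r)} := by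
    intro ω hω
    exact ENNReal.ofReal_le_ofReal (Real.rpow_le_rpow hy.le hω hr.le)
  refine (measure_mono hsub).trans (h1.trans ((ENNReal.div_le_div_right h _).trans ?_))
  rw [← ENNReal.ofReal_div_of_pos hyr, Real.rpow_neg hy.le, div_eq_mul_inv]

/-- Tail bound for the all-time supremum `sup_{t ≥ 0} (n' t - ∑_{i=1}^{n'} N_i(t) - ν t)`,
where the `N_i` are the counting processes of i.i.d. equilibrium renewal processes with
renewal distribution `S`, `E[S] = 1`, given central-moment bounds on the pooled process
for `t ≥ 1` and `t ∈ [0,1]`.  Here `ξ i 0` is the first (equilibrium-distributed) renewal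
interval of the `i`-th process, `ξ i (j+1)` its subsequent intervals, distributed as `S`,
all jointly independent. -/
theorem pooled_all_time_sup
    {Ω : Type*} [MeasurableSpace Ω] (μ : Measure Ω) [IsProbabilityMeasure μ]
    (S : Ω → ℝ) (hSmeas : Measurable S) (hSnn : ∀ᵐ ω ∂μ, 0 ≤ S ω)
    (hES : ∫ ω, S ω ∂μ = 1)
    (ξ : ℕ → ℕ → Ω → ℝ)
    (hξmeas : ∀ i j, Measurable (ξ i j))
    (hξnn : ∀ i j, ∀ᵐ ω ∂μ, 0 ≤ ξ i j ω)
    (hindep : iIndepFun (fun p : ℕ × ℕ => ξ p.1 p.2) μ)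
    (hlaw : ∀ i j, μ.map (ξ i (j + 1)) = μ.map S)
    (heq : ∀ i, ∀ y : ℝ, 0 ≤ y →
      (μ {ω | y < ξ i 0 ω}).toReal = ∫ z in Set.Ioi y, (μ {ω | z < S ω}).toReal)
    (n' : ℕ) (hn' : 1 ≤ n')
    (C₁ C₂ s₁ r₁ r₂ : ℝ) (hC₁ : 0 < C₁) (hC₂ : 0 < C₂)
    (hs₁ : 1 < s₁) (hr₁ : s₁ < r₁) (hr₂ : 2 < r₂)
    (hmom1 : ∀ t : ℝ, 1 ≤ t →
      ∫⁻ ω, ENNReal.ofReal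
          (|(∑ i ∈ Finset.range n', (renewalCount (fun j => ξ i j ω) t : ℝ)) - (n' : ℝ) * t| ^ r₁) ∂μ
        ≤ ENNReal.ofReal (C₁ * (n' : ℝ) ^ (r₁ / 2) * t ^ s₁))
    (hmom2 : ∀ t : ℝ, 0 ≤ t → t ≤ 1 →
      ∫⁻ ω, ENNReal.ofReal
          (|(∑ i ∈ Finset.range n', (renewalCount (fun j => ξ i j ω) t : ℝ)) - (n' : ℝ) * t| ^ r₂) ∂μ
        ≤ ENNReal.ofReal (C₂ * max ((n' : ℝ) * t) (((n' : ℝ) * t) ^ (r₂ / 2)))) :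
    ∀ ν : ℝ, 0 < ν → ∀ lam : ℝ, 8 ≤ lam →
      (μ {ω | (lam : EReal) ≤ ⨆ t : ℝ≥0,
          (((n' : ℝ) * (t : ℝ)
            - ∑ i ∈ Finset.range n', (renewalCount (fun j => ξ i j ω) (t : ℝ) : ℝ)
            - ν * (t : ℝ) : ℝ) : EReal)}).toReal
        ≤ (100 * (r₁ + r₂) ^ 3 / ((s₁ - 1) * (r₁ - s₁) * (r₂ - 2))) ^ (r₁ + r₂ + 2) *
            (C₁ * (n' : ℝ) ^ (r₁ / 2) * ν ^ (-s₁) * lam ^ (-(r₁ - s₁))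
              + C₂ * (n' : ℝ) ^ (r₂ / 2) * (lam * ν) ^ (-(r₂ / 2))) := by
  intro ν hν lam hlam
  obtain ⟨hmono, hmeas, hstat⟩ :=
    ren_pooled S hSmeas hSnn hES ξ hξmeas hξnn hindep hlaw heq n'
  obtain ⟨b1, b2, b3⟩ := ch_b hs₁ hr₁ hr₂
  set b := 100 * (r₁ + r₂) ^ 3 / ((s₁ - 1) * (r₁ - s₁) * (r₂ - 2)) with hb
  have hn1 : (1:ℝ) ≤ n' := by exact_mod_cast hn'
  have hn0 : (0:ℝ) < n' := by linarith
  have hlam0 : 0 < lam := by linarith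
  have q1 : 0 < s₁ - 1 := by linarith
  have q2 : 0 < r₁ - s₁ := by linarith
  have q3 : 0 < r₂ - 2 := by linarith
  have q4 : 0 < r₂ := by linarith
  have q5 : 0 < r₁ := by linarith
  have hb400 : 400 ≤ b := by
    refine le_trans ?_ b1
    rw [le_div_iff₀ q1]; linarith
  have hRHS : 0 ≤ b ^ (r₁ + r₂ + 2) * (C₁ * (n' : ℝ) ^ (r₁ / 2) * ν ^ (-s₁) * lam ^ (-(r₁ - s₁))
      + C₂ * (n' : ℝ) ^ (r₂ / 2) * (lam * ν) ^ (-(r₂ / 2))) := by positivity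
  refine ENNReal.toReal_le_of_le_ofReal hRHS ?_
  set A : ℝ → Ω → ℝ := fun t ω => ∑ i ∈ Finset.range n', (renewalCount (fun j => ξ i j ω) t : ℝ)
    with hA
  have hA0 : ∀ t ω, 0 ≤ A t ω := fun t ω => Finset.sum_nonneg fun i _ => Nat.cast_nonneg _
  have hsub : {ω | (lam : EReal) ≤ ⨆ t : ℝ≥0, (((n' : ℝ) * (t : ℝ)
            - ∑ i ∈ Finset.range n', (renewalCount (fun j => ξ i j ω) (t : ℝ) : ℝ)
            - ν * (t : ℝ) : ℝ) : EReal)}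
      ⊆ {ω | ∃ t, 0 ≤ t ∧ lam / 2 < n' * t - A t ω - ν * t} := by
    intro ω hω
    have h1 : ((lam / 2 : ℝ) : EReal) < lam := EReal.coe_lt_coe_iff.2 (by linarith)
    obtain ⟨t, ht⟩ := lt_iSup_iff.1 (lt_of_lt_of_le h1 hω)
    exact ⟨t, t.2, EReal.coe_lt_coe_iff.1 ht⟩
  refine (measure_mono hsub).trans ?_
  rcases le_or_gt (n' : ℝ) ν with hc | hc
  · have : {ω | ∃ t, 0 ≤ t ∧ lam / 2 < n' * t - A t ω - ν * t} = ∅ := by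
      rw [Set.eq_empty_iff_forall_notMem]
      rintro ω ⟨t, ht, h⟩
      have := hA0 t ω
      nlinarith [mul_le_mul_of_nonneg_right hc ht]
    rw [this]; simp
  have hD1 : 0 ≤ C₁ * (n' : ℝ) ^ (r₁ / 2) := by positivity
  have hD2 : 0 ≤ C₂ * (n' : ℝ) ^ (r₂ / 2) := by positivity
  have htail : ∀ s h y : ℝ, 0 ≤ s → 0 < h → 1 ≤ n' * h → 0 < y →
      μ {ω | y ≤ |A (s+h) ω - A s ω - n' * h|}
        ≤ ENNReal.ofReal (C₁ * (n' : ℝ) ^ (r₁ / 2) * h ^ s₁ * y ^ (-r₁)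
          + C₂ * (n' : ℝ) ^ (r₂ / 2) * h ^ (r₂ / 2) * y ^ (-r₂)) := by
    intro s h y hs hh hnh hy
    have hXm : Measurable fun ω => A (s+h) ω - A s ω - n' * h :=
      ((hmeas _).sub (hmeas _)).sub_const _
    have hst : ∀ r : ℝ, ∫⁻ ω, ENNReal.ofReal (|A (s+h) ω - A s ω - n' * h| ^ r) ∂μ
        = ∫⁻ ω, ENNReal.ofReal (|A h ω - n' * h| ^ r) ∂μ := fun r =>
      hstat s h hs hh.le (fun x => ENNReal.ofReal (|x - n' * h| ^ r))
        (ENNReal.measurable_ofReal.comp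
          ((continuous_abs.measurable.comp (measurable_id.sub_const _)).pow_const r))
    rcases le_total 1 h with h1 | h1
    · refine (ch_markov hXm q5 hy ((hst r₁).trans_le (hmom1 h h1))).trans
        (ENNReal.ofReal_le_ofReal ?_)
      have : 0 ≤ C₂ * (n' : ℝ) ^ (r₂ / 2) * h ^ (r₂ / 2) * y ^ (-r₂) := by positivity
      linarith
    · refine (ch_markov hXm q4 hy ((hst r₂).trans_le (hmom2 h hh.le h1))).trans
        (ENNReal.ofReal_le_ofReal ?_)
      have : 0 ≤ C₁ * (n' : ℝ) ^ (r₁ / 2) * h ^ s₁ * y ^ (-r₁) := by positivity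
      have e : max ((n' : ℝ) * h) (((n' : ℝ) * h) ^ (r₂ / 2))
          = (n' : ℝ) ^ (r₂ / 2) * h ^ (r₂ / 2) := by
        rw [← Real.mul_rpow hn0.le hh.le]
        exact max_eq_right (Real.self_le_rpow_of_one_le hnh (by linarith))
      rw [e, ← mul_assoc]
      linarith
  refine (chain_main A hA0 hmono n' ν lam hν hc hlam _ s₁ r₁ _ (r₂ / 2) r₂ hD1 hD2 hs₁ hr₁
    (by linarith) (by linarith) htail).trans (ENNReal.ofReal_le_ofReal ?_)
  have f1 := ch_const (P := r₁ + r₂ + 2) hD1 hν hlam0 hs₁ hr₁ (by linarith : 1 ≤ b)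
    (le_trans (div_le_div_of_nonneg_right (by linarith) q1.le) b1)
    (le_trans (by rw [le_div_iff₀ q1, add_mul, div_mul_cancel₀ _ q1.ne']; linarith) b1)
    (le_trans (by rw [le_div_iff₀ q2, add_mul, div_mul_cancel₀ _ q2.ne']; linarith) b2)
    (by linarith)
  have q6 : 0 < r₂ / 2 - 1 := by linarith
  have q7 : 0 < r₂ - r₂ / 2 := by linarith
  have f2 := ch_const (P := r₁ + r₂ + 2) (σ := r₂ / 2) (ρ := r₂) hD2 hν hlam0
    (by linarith) (by linarith) (by linarith : 1 ≤ b)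
    (le_trans (by rw [div_le_div_iff₀ q6 q3]; nlinarith [mul_pos q4 q3, mul_pos q5 q3]) b3)
    (le_trans (by
      rw [le_div_iff₀ q3, show r₂ - 2 = (r₂ / 2 - 1) * 2 by ring, ← mul_assoc, add_mul,
        div_mul_cancel₀ _ q6.ne']
      linarith) b3)
    (le_trans (show _ ≤ (3:ℝ) by
      have : 2 / (r₂ - r₂ / 2) ≤ 2 := by rw [div_le_iff₀ q7]; linarith
      linarith) (by linarith))
    (by linarith)
  have e : ν ^ (-(r₂ / 2)) * lam ^ (-(r₂ - r₂ / 2)) = (lam * ν) ^ (-(r₂ / 2)) := by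
    rw [Real.mul_rpow hlam0.le hν.le, show r₂ - r₂ / 2 = r₂ / 2 by ring]; ring
  rw [mul_assoc _ (ν ^ (-(r₂ / 2))), e] at f2
  rw [mul_add]
  exact add_le_add f1 f2
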